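/- Suppose the meromorphic mapping Φ = (φ₁,…,φ_n) admits an algebraic addition theorem. Then for every k, p ∈ {1,…,n} there exists a nonzero polynomial H_{kp} in 4n variables x₁,…,x_n, x'₁,…,x'_n, y₁,…,y_n, y'₁,…,y'_n, invariant under the simultaneous interchange x_i ↔ y_i, x'_i ↔ y'_i (i = 1,…,n), such that H_{kp}(φ₁(u),…,φ_n(u), ∂φ₁/∂u_p(u),…,∂φ_n/∂u_p(u), φ₁(v),…,φ_n(v), ∂φ₁/∂u_p(v),…,∂φ_n/∂u_p(v)) = 0 for every pair (u, v) at which all of φ₁,…,φ_n and their first-order partial derivatives are analytic. -/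

import Mathlib

open MvPolynomial

/-- The partial derivative `∂f/∂u_p` of a function on ℂⁿ. -/
noncomputable def pd {n : ℕ} (f : (Fin n → ℂ) → ℂ) (p : Fin n) (u : Fin n → ℂ) : ℂ :=
  fderiv ℂ f u (Pi.single p 1)

/-- `f` is meromorphic on ℂⁿ: a quotient of two everywhere-analytic functions. -/
def Mero {n : ℕ} (f : (Fin n → ℂ) → ℂ) : Prop :=
  ∃ g h : (Fin n → ℂ) → ℂ, (∀ u, AnalyticAt ℂ g u) ∧ (∀ u, AnalyticAt ℂ h u) ∧
    (∃ u, h u ≠ 0) ∧ ∀ u, h u ≠ 0 → f u = g u / h u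

/-- The Jacobian determinant of the family `φ` is not identically zero. -/
def AnalyticallyIndep {n : ℕ} (φ : Fin n → (Fin n → ℂ) → ℂ) : Prop :=
  ∃ u : Fin n → ℂ, (∀ j, AnalyticAt ℂ (φ j) u) ∧
    Matrix.det (Matrix.of fun k p => pd (φ k) p u) ≠ 0

/-- `Φ = (φ₁,…,φ_n)` admits an algebraic addition theorem: for each `k` there is a
polynomial `G_k` in the variables `λ` (= `none`), `x_j` (= `some (inl j)`) and
`y_j` (= `some (inr j)`), of degree ≥ 1 in `λ`, with
`G_k(φ_k(u+v); φ(u), φ(v)) = 0` wherever all functions involved are analytic. -/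
def AdmitsAAT {n : ℕ} (φ : Fin n → (Fin n → ℂ) → ℂ) : Prop :=
  ∀ k : Fin n, ∃ G : MvPolynomial (Option (Fin n ⊕ Fin n)) ℂ,
    1 ≤ G.degreeOf none ∧
    ∀ u v : Fin n → ℂ, (∀ j, AnalyticAt ℂ (φ j) u) → (∀ j, AnalyticAt ℂ (φ j) v) →
      AnalyticAt ℂ (φ k) (u + v) →
      eval (fun i => i.elim (φ k (u + v)) (Sum.elim (fun j => φ j u) fun j => φ j v)) G = 0

/-- The valuation sending the variable `none` to `θ(u)` and `some j` to `φ_j(u)`. -/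
noncomputable def tval {n : ℕ} (θ : (Fin n → ℂ) → ℂ) (φ : Fin n → (Fin n → ℂ) → ℂ)
    (u : Fin n → ℂ) : Option (Fin n) → ℂ :=
  fun i => i.elim (θ u) fun j => φ j u

/-- `f` is a rational function on ℂⁿ. -/
def RatFn {n : ℕ} (f : (Fin n → ℂ) → ℂ) : Prop :=
  ∃ P Q : MvPolynomial (Fin n) ℂ, Q ≠ 0 ∧
    ∃ s : Set (Fin n → ℂ), IsOpen s ∧ s.Nonempty ∧
      ∀ u ∈ s, f u = eval u P / eval u Q

open Topology Filter in
theorem aux_preconn {E : Type*} [NormedAddCommGroup E] [NormedSpace ℂ E] (D : E → ℂ)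
    (hD : ∀ z, AnalyticAt ℂ D z) : IsPreconnected {z | D z ≠ 0} := by
  apply isPreconnected_of_forall_pair
  intro a ha b hb
  let L : ℂ → E := fun t => a + t • (b - a)
  have hL : ∀ t, AnalyticAt ℂ L t := fun t => by
    have : Differentiable ℂ L := by unfold L; fun_prop
    unfold L
    exact analyticAt_const.add (analyticAt_id.smul analyticAt_const)
  let f : ℂ → ℂ := fun t => D (L t)
  have hf : AnalyticOnNhd ℂ f Set.univ := fun t _ => (hD (L t)).comp (hL t)
  have h0 : f 0 ≠ 0 := by simpa [f, L] using ha
  have hdisc : IsDiscrete (f ⁻¹' {0}) := by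
    rw [isDiscrete_iff_discreteTopology, discreteTopology_subtype_iff]
    intro x hx
    rw [← disjoint_iff, disjoint_principal_right]
    rcases (hf x trivial).eventually_eq_zero_or_eventually_ne_zero with h | h
    · exfalso
      exact h0 (hf.eqOn_zero_of_preconnected_of_eventuallyEq_zero isPreconnected_univ trivial h
        trivial)
    · exact h
  have hcount : (f ⁻¹' {0}).Countable :=
    IsLindelof.countable_of_isDiscrete (HereditarilyLindelofSpace.isLindelof _) hdisc
  have hc := (Set.Countable.isConnected_compl_of_one_lt_rank (E := ℂ) (by simp) hcount).2
  refine ⟨L '' (f ⁻¹' {0})ᶜ, ?_, ⟨0, ?_, ?_⟩, ⟨1, ?_, ?_⟩, ?_⟩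
  · rintro _ ⟨t, ht, rfl⟩
    exact ht
  · simpa using h0
  · simp [L]
  · simpa [f, L] using hb
  · simp [L]
  · exact hc.image _ (fun t _ => (hL t).continuousAt.continuousWithinAt)

open Topology Filter in
theorem aux_dense {E : Type*} [NormedAddCommGroup E] [NormedSpace ℂ E] (D : E → ℂ)
    (hD : ∀ z, AnalyticAt ℂ D z) (h : ∃ z, D z ≠ 0) : Dense {z | D z ≠ 0} := by
  intro x
  by_contra hx
  obtain ⟨z, hz⟩ := h
  apply hz
  have hf : AnalyticOnNhd ℂ D Set.univ := fun z _ => hD z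
  refine hf.eqOn_zero_of_preconnected_of_eventuallyEq_zero isPreconnected_univ
    (Set.mem_univ x) ?_ (Set.mem_univ z)
  rw [mem_closure_iff_frequently] at hx
  have hx' : ∀ᶠ y in 𝓝 x, D y = 0 := by simpa using hx
  exact hx'

open Topology Filter in
theorem aux_mul {E : Type*} [NormedAddCommGroup E] [NormedSpace ℂ E] {W : Set E}
    (hW : IsOpen W) (hW' : IsPreconnected W) {f g : E → ℂ}
    (hf : AnalyticOnNhd ℂ f W) (hg : AnalyticOnNhd ℂ g W) (h : ∀ z ∈ W, f z * g z = 0) :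
    (∀ z ∈ W, f z = 0) ∨ (∀ z ∈ W, g z = 0) := by
  by_contra! hc
  obtain ⟨⟨z, hz, hfz⟩, ⟨y, hy, hgy⟩⟩ := hc
  apply hgy
  refine hg.eqOn_zero_of_preconnected_of_eventuallyEq_zero hW' hz ?_ hy
  filter_upwards [hW.mem_nhds hz, (hf z hz).continuousAt.eventually_ne hfz] with x hx hx'
  exact (mul_eq_zero.1 (h x hx)).resolve_left hx'

theorem aux_chain {ι : Type*} [Fintype ι] (c : ℂ → ι → ℂ) (c' : ι → ℂ) (t : ℂ)
    (h : ∀ i, HasDerivAt (fun t => c t i) (c' i) t) (G : MvPolynomial ι ℂ) :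
    HasDerivAt (fun t => eval (c t) G) (∑ i, eval (c t) (pderiv i G) * c' i) t := by
  classical
  induction G using MvPolynomial.induction_on with
  | C a => simpa using hasDerivAt_const t a
  | add p q hp hq =>
    simp only [map_add]
    refine (hp.add hq).congr_deriv ?_
    simp [add_mul, Finset.sum_add_distrib]
  | mul_X p j hp =>
    have := hp.mul (h j)
    simp only [map_mul, eval_X]
    refine this.congr_deriv ?_
    simp [add_mul, Finset.sum_add_distrib, pderiv_X, Pi.single_apply, Finset.sum_mul,
      apply_ite, ite_mul]
    rw [add_comm]
    congr 1
    exact Finset.sum_congr rfl fun i _ => by ring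

theorem aux_pderiv_deg {ι : Type*} (G : MvPolynomial ι ℂ) (i : ι) (h : pderiv i G ≠ 0) :
    (pderiv i G).totalDegree < G.totalDegree := by
  classical
  obtain ⟨m, hm, hm'⟩ := (pderiv i G).support.exists_mem_eq_sup
    (support_nonempty.2 h) (fun s => s.sum fun _ e => e)
  rw [totalDegree, hm']
  rw [mem_support_iff, coeff_pderiv] at hm
  have h2 := le_totalDegree (mem_support_iff.2 (left_ne_zero_of_mul hm))
  rw [Finsupp.sum_add_index' (by simp) (by simp)] at h2
  simp only [Finsupp.sum_single_index] at h2
  omega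

theorem aux_pderiv_zero {ι : Type*} (G : MvPolynomial ι ℂ) (h : ∀ i, pderiv i G = 0) :
    ∃ a, G = C a := by
  classical
  refine ⟨coeff 0 G, ?_⟩
  ext m
  rw [coeff_C]
  split_ifs with hm
  · rw [hm]
  · have : ∃ i, m i ≠ 0 := by
      by_contra! hc
      exact hm (Finsupp.ext fun i => (hc i).symm)
    obtain ⟨i, hi⟩ := this
    have h1 := coeff_pderiv (i := i) G (m - Finsupp.single i 1)
    rw [h i, coeff_zero, tsub_add_cancel_of_le (by simpa [Nat.one_le_iff_ne_zero] using hi)] at h1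
    rcases mul_eq_zero.1 h1.symm with h2 | h2
    · exact h2
    · exact absurd h2 (Nat.cast_add_one_ne_zero _)

theorem aux_alg {A s τ : Type*} [CommRing A] [IsDomain A] [Algebra ℂ A] [Fintype τ]
    (a : s → A) (t : τ → A) (w : A) (hind : AlgebraicIndependent ℂ (Sum.elim t a))
    (G : MvPolynomial (Option s) ℂ) (hG : G ≠ 0)
    (hGw : aeval (fun o : Option s => o.elim w a) G = 0)
    (g : τ → MvPolynomial (Option s) ℂ)
    (hg : ∑ i, aeval (fun o : Option s => o.elim w a) (g i) * t i = 0) (i : τ) :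
    aeval (fun o : Option s => o.elim w a) (g i) = 0 := by
  obtain ⟨ha, ht⟩ := AlgebraicIndependent.sumElim_iff.1 hind
  let R0 := Algebra.adjoin ℂ (Set.range a)
  have hw : IsAlgebraic R0 w := by
    by_contra hc
    have := (ha.option_iff_transcendental w).2 hc
    exact hG (this.eq_zero_of_aeval_eq_zero G hGw)
  let S := Algebra.adjoin R0 {w}
  have : Algebra.IsAlgebraic R0 S := by
    have h1 := Algebra.isAlgebraic_adjoin_singleton_iff.2 hw
    exact (Subalgebra.isAlgebraic_iff _).1 h1
  have htS : AlgebraicIndependent S t := ht.extendScalars S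
  have hmem : ∀ q : MvPolynomial (Option s) ℂ, aeval (fun o : Option s => o.elim w a) q ∈ S := by
    intro q
    induction q using MvPolynomial.induction_on with
    | C c =>
      rw [algHom_C]
      exact S.algebraMap_mem (algebraMap ℂ R0 c)
    | add p q hp hq => rw [map_add]; exact S.add_mem hp hq
    | mul_X p j hp =>
      rw [map_mul, aeval_X]
      refine S.mul_mem hp ?_
      cases j with
      | none => exact Algebra.subset_adjoin rfl
      | some j => exact S.algebraMap_mem (⟨a j, Algebra.subset_adjoin ⟨j, rfl⟩⟩ : R0)
  have hl := Fintype.linearIndependent_iff.1 htS.linearIndependent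
    (fun i => (⟨_, hmem (g i)⟩ : S)) (by simpa [Subalgebra.smul_def] using hg) i
  simpa using congrArg Subtype.val hl

theorem aux_prod {E ι : Type*} [NormedAddCommGroup E] [NormedSpace ℂ E] (F : ι → E → ℂ)
    (hF : ∀ i z, AnalyticAt ℂ (F i) z) (hne : ∀ i, ∃ z, F i z ≠ 0) (S : Finset ι) :
    (∀ z, AnalyticAt ℂ (fun z => ∏ i ∈ S, F i z) z) ∧ ∃ z, ∏ i ∈ S, F i z ≠ 0 := by
  classical
  induction S using Finset.induction_on with
  | empty => simpa using fun z => analyticAt_const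
  | insert i S hi ih =>
    obtain ⟨ih1, z, hz⟩ := ih
    have h1 : ∀ z, AnalyticAt ℂ (fun z => F i z * ∏ i ∈ S, F i z) z :=
      fun z => (hF i z).mul (ih1 z)
    simp only [Finset.prod_insert hi]
    refine ⟨h1, ?_⟩
    by_contra! hc
    rcases aux_mul (isOpen_univ (X := E)) isPreconnected_univ (fun z _ => hF i z)
      (fun z _ => ih1 z) (fun z _ => hc z) with h | h
    · obtain ⟨y, hy⟩ := hne i
      exact hy (h y trivial)
    · exact hz (h z trivial)

/-- The algebra of functions on `W` that are restrictions of functions analytic on `W`. -/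
def anaAlg {E : Type*} [NormedAddCommGroup E] [NormedSpace ℂ E] (W : Set E) :
    Subalgebra ℂ (W → ℂ) where
  carrier := {f | ∃ F : E → ℂ, AnalyticOnNhd ℂ F W ∧ ∀ z : W, f z = F z}
  mul_mem' := by
    rintro f g ⟨F, hF, hf⟩ ⟨G, hG, hg⟩
    exact ⟨fun z => F z * G z, hF.mul hG, fun z => by simp [hf, hg]⟩
  add_mem' := by
    rintro f g ⟨F, hF, hf⟩ ⟨G, hG, hg⟩
    exact ⟨fun z => F z + G z, hF.add hG, fun z => by simp [hf, hg]⟩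
  algebraMap_mem' c := ⟨fun _ => c, analyticOnNhd_const, fun z => rfl⟩

theorem anaAlg_isDomain {E : Type*} [NormedAddCommGroup E] [NormedSpace ℂ E] (W : Set E)
    (hW : IsOpen W) (hW' : IsPreconnected W) (hne : W.Nonempty) : IsDomain (anaAlg W) := by
  obtain ⟨z0, hz0⟩ := hne
  have : Nontrivial (anaAlg W) := by
    refine ⟨0, 1, fun h => ?_⟩
    have := congrFun (congrArg Subtype.val h) ⟨z0, hz0⟩
    simp at this
  have : NoZeroDivisors (anaAlg W) := by
    refine ⟨?_⟩
    rintro ⟨f, F, hF, hf⟩ ⟨g, G, hG, hg⟩ h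
    have h' : ∀ z ∈ W, F z * G z = 0 := by
      intro z hz
      have := congrFun (congrArg Subtype.val h) ⟨z, hz⟩
      simpa [hf, hg] using this
    rcases aux_mul hW hW' hF hG h' with h | h
    · left
      ext z
      simpa [hf] using h z z.2
    · right
      ext z
      simpa [hg] using h z z.2
  exact NoZeroDivisors.to_isDomain _

theorem anaAlg_aeval {E ι : Type*} [NormedAddCommGroup E] [NormedSpace ℂ E] (W : Set E)
    (b : ι → anaAlg W) (q : MvPolynomial ι ℂ) (z : W) :
    (aeval b q).1 z = eval (fun i => (b i).1 z) q := by
  exact comp_aeval_apply b ((Pi.evalAlgHom ℂ (fun _ : W => ℂ) z).comp (anaAlg W).val) q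

theorem anaAlg_aeval_zero {E ι : Type*} [NormedAddCommGroup E] [NormedSpace ℂ E] (W : Set E)
    (b : ι → anaAlg W) (q : MvPolynomial ι ℂ) :
    aeval b q = 0 ↔ ∀ z : W, eval (fun i => (b i).1 z) q = 0 := by
  constructor
  · intro h z
    rw [← anaAlg_aeval, h]
    rfl
  · intro h
    ext z
    rw [anaAlg_aeval, h]
    rfl

theorem aux_core {E s : Type*} [NormedAddCommGroup E] [NormedSpace ℂ E] [Fintype s] (W : Set E)
    (hW : IsOpen W) (hW' : IsPreconnected W) (hne : W.Nonempty)
    (a t : s → E → ℂ) (w : E → ℂ) (ε : s → ℂ) (hε : ∀ i, ε i ≠ 0)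
    (ha : ∀ i, AnalyticOnNhd ℂ (a i) W) (ht : ∀ i, AnalyticOnNhd ℂ (t i) W)
    (hw : AnalyticOnNhd ℂ w W)
    (G : MvPolynomial (Option s) ℂ) (hG0 : G ≠ 0)
    (hG : ∀ z ∈ W, eval (fun o : Option s => o.elim (w z) fun i => a i z) G = 0)
    (hder : ∀ G : MvPolynomial (Option s) ℂ,
      (∀ z ∈ W, eval (fun o : Option s => o.elim (w z) fun i => a i z) G = 0) →
      ∀ z ∈ W, ∑ i, ε i * eval (fun o : Option s => o.elim (w z) fun i => a i z)
        (pderiv (some i) G) * t i z = 0)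
    (hlam : ∀ G : MvPolynomial (Option s) ℂ,
      (∀ z ∈ W, eval (fun o : Option s => o.elim (w z) fun i => a i z) G = 0) →
      (∀ i, pderiv (some i) G = 0) →
      ∀ z ∈ W, eval (fun o : Option s => o.elim (w z) fun i => a i z) (pderiv none G) = 0) :
    ∃ H : MvPolynomial (s ⊕ s) ℂ, H ≠ 0 ∧
      ∀ z ∈ W, eval (Sum.elim (fun i => t i z) fun i => a i z) H = 0 := by
  by_contra! hc
  have hdom := anaAlg_isDomain W hW hW' hne
  let a' : s → anaAlg W := fun i => ⟨fun z => a i z, a i, ha i, fun _ => rfl⟩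
  let t' : s → anaAlg W := fun i => ⟨fun z => t i z, t i, ht i, fun _ => rfl⟩
  let w' : anaAlg W := ⟨fun z => w z, w, hw, fun _ => rfl⟩
  have hind : AlgebraicIndependent ℂ (Sum.elim t' a') := by
    rw [algebraicIndependent_iff]
    intro H hH
    by_contra hH0
    obtain ⟨z, hz, hz'⟩ := hc H hH0
    apply hz'
    have := (anaAlg_aeval_zero W _ H).1 hH ⟨z, hz⟩
    convert this using 3
    funext i
    rcases i with i | i <;> rfl
  have hval : ∀ q : MvPolynomial (Option s) ℂ,
      aeval (fun o : Option s => o.elim w' a') q = 0 ↔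
      ∀ z ∈ W, eval (fun o : Option s => o.elim (w z) fun i => a i z) q = 0 := by
    intro q
    rw [anaAlg_aeval_zero, Subtype.forall]
    refine forall₂_congr fun z hz => ?_
    have : (fun i : Option s => (i.elim w' a').1 ⟨z, hz⟩) =
        (fun o : Option s => o.elim (w z) fun i => a i z) := by
      funext o
      cases o <;> rfl
    rw [this]
  obtain ⟨G, ⟨hG0, hG⟩, hmin⟩ := WellFounded.has_min
    (measure (fun q : MvPolynomial (Option s) ℂ => q.totalDegree)).wf
    {q | q ≠ 0 ∧ ∀ z ∈ W, eval (fun o : Option s => o.elim (w z) fun i => a i z) q = 0}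
    ⟨G, hG0, hG⟩
  have hlow : ∀ o, (∀ z ∈ W, eval (fun o : Option s => o.elim (w z) fun i => a i z)
      (pderiv o G) = 0) → pderiv o G = 0 := by
    intro o ho
    by_contra h0
    exact hmin _ ⟨h0, ho⟩ (aux_pderiv_deg G o h0)
  have hsome : ∀ i, pderiv (some i) G = 0 := by
    intro i
    apply hlow
    have h1 := aux_alg a' t' w' hind G hG0 ((hval G).2 hG)
      (fun i => C (ε i) * pderiv (some i) G) (by
        ext z
        have h2 := hder G hG z z.2
        have h3 : ∀ i, (aeval (fun o : Option s => o.elim w' a') (pderiv (some i) G)).1 z =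
            eval (fun o : Option s => o.elim (w z) fun i => a i z) (pderiv (some i) G) := by
          intro i
          rw [anaAlg_aeval]
          congr 2
          funext o
          cases o <;> rfl
        simp only [← h3] at h2
        simp only [map_mul, algHom_C]
        rw [AddSubmonoidClass.coe_finsetSum, Finset.sum_apply]
        exact h2) i
    rw [hval] at h1
    intro z hz
    have := h1 z hz
    rw [map_mul, eval_C] at this
    exact (mul_eq_zero.1 this).resolve_left (hε i)
  have hnone : pderiv none G = 0 := hlow _ (hlam G hG hsome)
  obtain ⟨c, hcG⟩ := aux_pderiv_zero G (fun o => by cases o; exacts [hnone, hsome _])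
  obtain ⟨z, hz⟩ := hne
  have := hG z hz
  rw [hcG, eval_C] at this
  exact hG0 (by rw [hcG, this, C_0])

theorem mero_analyticAt {n : ℕ} {f g h : (Fin n → ℂ) → ℂ} (hg : ∀ u, AnalyticAt ℂ g u)
    (hh : ∀ u, AnalyticAt ℂ h u) (hf : ∀ u, h u ≠ 0 → f u = g u / h u) {u : Fin n → ℂ}
    (hu : h u ≠ 0) : AnalyticAt ℂ f u := by
  refine ((hg u).div (hh u) hu).congr ?_
  filter_upwards [(hh u).continuousAt.eventually_ne hu] with x hx
  exact (hf x hx).symm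

theorem pd_analyticAt {n : ℕ} {f : (Fin n → ℂ) → ℂ} {u : Fin n → ℂ} (hf : AnalyticAt ℂ f u)
    (q : Fin n) : AnalyticAt ℂ (pd f q) u :=
  ((ContinuousLinearMap.apply ℂ ℂ (Pi.single q 1 : Fin n → ℂ)).analyticAt _).comp hf.fderiv

theorem pd_hasDerivAt {n : ℕ} {f : (Fin n → ℂ) → ℂ} {u : Fin n → ℂ} (hf : AnalyticAt ℂ f u)
    (q : Fin n) (c : ℂ) :
    HasDerivAt (fun t : ℂ => f (u + (t * c) • Pi.single q 1)) (c * pd f q u) 0 := by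
  have h1 : HasDerivAt (fun t : ℂ => u + (t * c) • (Pi.single q 1 : Fin n → ℂ))
      (c • (Pi.single q 1 : Fin n → ℂ)) 0 := by
    have h0 : HasDerivAt (fun t : ℂ => t * c) c 0 := by
      simpa using (hasDerivAt_id (0 : ℂ)).mul_const c
    exact (h0.smul_const (Pi.single q 1 : Fin n → ℂ)).const_add u
  have h2 : HasFDerivAt f (fderiv ℂ f u) (u + ((0 : ℂ) * c) • (Pi.single q 1 : Fin n → ℂ)) := by
    simpa using hf.differentiableAt.hasFDerivAt
  refine (h2.comp_hasDerivAt (0 : ℂ) h1).congr_deriv ?_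
  simp [pd]

/-- A function continuous at a point and vanishing on a dense set vanishes at the point. -/
theorem aux_closure {E : Type*} [TopologicalSpace E] {W : Set E} (hW : Dense W) {f : E → ℂ}
    {z : E} (hf : ContinuousAt f z) (h : ∀ y ∈ W, f y = 0) : f z = 0 := by
  have hcl : z ∈ closure W := hW z
  have h1 := hf.continuousWithinAt.mem_closure_image hcl
  have h2 : f '' W ⊆ {0} := by
    rintro _ ⟨y, hy, rfl⟩
    exact h y hy
  simpa using closure_mono h2 h1

theorem eval_continuousAt {E ι : Type*} [TopologicalSpace E] {b : E → ι → ℂ} {z : E}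
    (hb : ∀ i, ContinuousAt (fun z => b z i) z) (q : MvPolynomial ι ℂ) :
    ContinuousAt (fun z => eval (b z) q) z :=
  (MvPolynomial.continuous_eval q).continuousAt.comp (continuousAt_pi.2 hb)

/-- Reordering of the variables. -/
def reIdx (n : ℕ) : (Fin n ⊕ Fin n) ⊕ (Fin n ⊕ Fin n) → (Fin n ⊕ Fin n) ⊕ (Fin n ⊕ Fin n)
  | .inl (.inl j) => .inl (.inr j)
  | .inl (.inr j) => .inr (.inr j)
  | .inr (.inl j) => .inl (.inl j)
  | .inr (.inr j) => .inr (.inl j)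

theorem reIdx_inj (n : ℕ) : Function.Injective (reIdx n) := by
  rintro ((i | i) | (i | i)) ((j | j) | (j | j)) h <;> simp_all [reIdx]

theorem aat_symmetric_eliminant {n : ℕ} (hn : 1 ≤ n) (φ : Fin n → (Fin n → ℂ) → ℂ)
    (hmero : ∀ k, Mero (φ k)) (hindep : AnalyticallyIndep φ) (haat : AdmitsAAT φ)
    (k p : Fin n) :
    ∃ H : MvPolynomial ((Fin n ⊕ Fin n) ⊕ (Fin n ⊕ Fin n)) ℂ, H ≠ 0 ∧
      rename Sum.swap H = H ∧
      ∀ u v : Fin n → ℂ,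
        (∀ j, AnalyticAt ℂ (φ j) u) → (∀ j q, AnalyticAt ℂ (pd (φ j) q) u) →
        (∀ j, AnalyticAt ℂ (φ j) v) → (∀ j q, AnalyticAt ℂ (pd (φ j) q) v) →
        eval (Sum.elim
          (Sum.elim (fun j => φ j u) fun j => pd (φ j) p u)
          (Sum.elim (fun j => φ j v) fun j => pd (φ j) p v)) H = 0 := by
  classical
  choose g h hg hh hne hgh using hmero
  let E := (Fin n → ℂ) × (Fin n → ℂ)
  let F : Option (Fin n ⊕ Fin n) → E → ℂ := fun o z =>
    o.elim (h k (z.1 + z.2)) (Sum.elim (fun j => h j z.1) fun j => h j z.2)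
  have hfst : ∀ z : E, AnalyticAt ℂ (fun z : E => z.1) z := fun z => analyticAt_fst
  have hsnd : ∀ z : E, AnalyticAt ℂ (fun z : E => z.2) z := fun z => analyticAt_snd
  have hadd : ∀ z : E, AnalyticAt ℂ (fun z : E => z.1 + z.2) z :=
    fun z => (hfst z).add (hsnd z)
  have hF : ∀ i z, AnalyticAt ℂ (F i) z := by
    rintro (_ | (j | j)) z
    · exact AnalyticAt.comp (f := fun z : E => z.1 + z.2) (hh k (z.1 + z.2)) (hadd z)
    · exact (hh j z.1).comp (hfst z)
    · exact (hh j z.2).comp (hsnd z)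
  have hFne : ∀ i, ∃ z, F i z ≠ 0 := by
    rintro (_ | (j | j))
    · obtain ⟨u, hu⟩ := hne k
      exact ⟨(u, 0), by simpa [F] using hu⟩
    · obtain ⟨u, hu⟩ := hne j
      exact ⟨(u, 0), by simpa [F] using hu⟩
    · obtain ⟨u, hu⟩ := hne j
      exact ⟨(0, u), by simpa [F] using hu⟩
  obtain ⟨hD, hDne⟩ := aux_prod F hF hFne Finset.univ
  let W : Set E := {z | ∏ i, F i z ≠ 0}
  have hWpre : IsPreconnected W := aux_preconn _ hD
  have hWdense : Dense W := aux_dense _ hD hDne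
  have hWopen : IsOpen W :=
    isOpen_ne_fun (continuous_iff_continuousAt.2 fun z => (hD z).continuousAt) continuous_const
  have hWF : ∀ z ∈ W, ∀ i, F i z ≠ 0 := fun z hz i => Finset.prod_ne_zero_iff.1 hz i (by simp)
  have hφ1 : ∀ z ∈ W, ∀ j, AnalyticAt ℂ (φ j) z.1 := fun z hz j =>
    mero_analyticAt (hg j) (hh j) (hgh j) (hWF z hz (some (.inl j)))
  have hφ2 : ∀ z ∈ W, ∀ j, AnalyticAt ℂ (φ j) z.2 := fun z hz j =>
    mero_analyticAt (hg j) (hh j) (hgh j) (hWF z hz (some (.inr j)))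
  have hφ3 : ∀ z ∈ W, AnalyticAt ℂ (φ k) (z.1 + z.2) := fun z hz =>
    mero_analyticAt (hg k) (hh k) (hgh k) (hWF z hz none)
  let a : Fin n ⊕ Fin n → E → ℂ := Sum.elim (fun j z => φ j z.1) (fun j z => φ j z.2)
  let t : Fin n ⊕ Fin n → E → ℂ :=
    Sum.elim (fun j z => pd (φ j) p z.1) (fun j z => pd (φ j) p z.2)
  let w : E → ℂ := fun z => φ k (z.1 + z.2)
  let ε : Fin n ⊕ Fin n → ℂ := Sum.elim (fun _ => 1) (fun _ => -1)
  have ha : ∀ i, AnalyticOnNhd ℂ (a i) W := by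
    rintro (j | j) z hz
    · exact (hφ1 z hz j).comp (hfst z)
    · exact (hφ2 z hz j).comp (hsnd z)
  have ht : ∀ i, AnalyticOnNhd ℂ (t i) W := by
    rintro (j | j) z hz
    · exact (pd_analyticAt (hφ1 z hz j) p).comp (hfst z)
    · exact (pd_analyticAt (hφ2 z hz j) p).comp (hsnd z)
  have hw : AnalyticOnNhd ℂ w W := fun z hz => AnalyticAt.comp (f := fun z : E => z.1 + z.2) (hφ3 z hz) (hadd z)
  -- derivative of a vanishing polynomial along a line
  have hline : ∀ G : MvPolynomial (Option (Fin n ⊕ Fin n)) ℂ,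
      (∀ z ∈ W, eval (fun o : Option (Fin n ⊕ Fin n) => o.elim (w z) fun i => a i z) G = 0) →
      ∀ z ∈ W, ∀ (q : Fin n) (c d : ℂ),
        eval (fun o : Option (Fin n ⊕ Fin n) => o.elim (w z) fun i => a i z) (pderiv none G) *
          ((c + d) * pd (φ k) q (z.1 + z.2)) +
        ∑ i, eval (fun o : Option (Fin n ⊕ Fin n) => o.elim (w z) fun i => a i z)
          (pderiv (some i) G) * Sum.elim (fun j => c * pd (φ j) q z.1)
            (fun j => d * pd (φ j) q z.2) i = 0 := by
    intro G hG z hz q c d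
    let γ : ℂ → E := fun s =>
      (z.1 + (s * c) • Pi.single q 1, z.2 + (s * d) • Pi.single q 1)
    have hγ0 : γ 0 = z := by simp [γ]
    have hγc : Continuous γ := by unfold γ; fun_prop
    have hch := aux_chain
      (fun s => fun o : Option (Fin n ⊕ Fin n) => o.elim (w (γ s)) fun i => a i (γ s))
      (fun o => o.elim ((c + d) * pd (φ k) q (z.1 + z.2))
        (Sum.elim (fun j => c * pd (φ j) q z.1) (fun j => d * pd (φ j) q z.2))) 0 (by
        rintro (_ | (j | j))
        · have h1 := pd_hasDerivAt (hφ3 z hz) q (c + d)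
          refine h1.congr_of_eventuallyEq (Filter.Eventually.of_forall fun s => ?_)
          simp only [Option.elim, w, γ]
          congr 1
          rw [mul_add, add_smul]
          abel
        · exact pd_hasDerivAt (hφ1 z hz j) q c
        · exact pd_hasDerivAt (hφ2 z hz j) q d) G
    have hz0 : HasDerivAt (fun s => eval (fun o : Option (Fin n ⊕ Fin n) =>
        o.elim (w (γ s)) fun i => a i (γ s)) G) 0 0 := by
      refine (hasDerivAt_const (0 : ℂ) (0 : ℂ)).congr_of_eventuallyEq ?_
      have : ∀ᶠ s in nhds (0 : ℂ), γ s ∈ W :=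
        hγc.continuousAt.eventually (by rw [hγ0]; exact hWopen.mem_nhds hz)
      filter_upwards [this] with s hs
      exact hG _ hs
    have := hch.unique hz0
    rw [Fintype.sum_option] at this
    simpa only [hγ0, Option.elim] using this
  obtain ⟨G, hGdeg, hG⟩ := haat k
  have hG0 : G ≠ 0 := by
    rintro rfl
    simp at hGdeg
  have hGW : ∀ z ∈ W,
      eval (fun o : Option (Fin n ⊕ Fin n) => o.elim (w z) fun i => a i z) G = 0 := by
    intro z hz
    have := hG z.1 z.2 (hφ1 z hz) (hφ2 z hz) (hφ3 z hz)
    convert this using 3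
    funext o
    rcases o with _ | (j | j) <;> rfl
  obtain ⟨H, hH0, hH⟩ := aux_core W hWopen hWpre hDne a t w ε
    (by rintro (j | j) <;> simp [ε]) ha ht hw G hG0 hGW
    (by
      intro G hG z hz
      have := hline G hG z hz p 1 (-1)
      rw [add_neg_cancel, zero_mul, mul_zero, zero_add] at this
      rw [← this]
      refine Finset.sum_congr rfl ?_
      rintro (j | j) _ <;> simp [ε, t])
    (by
      intro G hG hsome
      by_contra hcon
      have hpd : ∀ q, ∀ z ∈ W, pd (φ k) q (z.1 + z.2) = 0 := by
        intro q
        refine (aux_mul hWopen hWpre (f := fun z => eval (fun o : Option (Fin n ⊕ Fin n) =>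
          o.elim (w z) fun i => a i z) (pderiv none G))
          (g := fun z => pd (φ k) q (z.1 + z.2)) ?_ ?_ ?_).resolve_left hcon
        · intro z hz
          have : AnalyticAt ℂ (fun z => aeval (fun o : Option (Fin n ⊕ Fin n) =>
              o.elim (w z) fun i => a i z) (pderiv none G)) z := by
            refine AnalyticAt.aeval_mvPolynomial ?_ _
            rintro (_ | j)
            · exact hw z hz
            · exact ha j z hz
          simpa only [aeval_eq_eval] using this
        · exact fun z hz => AnalyticAt.comp (f := fun z : E => z.1 + z.2)
            (pd_analyticAt (hφ3 z hz) q) (hadd z)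
        · intro z hz
          have := hline G hG z hz q 1 0
          simpa [hsome] using this
      obtain ⟨u0, hu0, hdet⟩ := hindep
      apply hdet
      apply Matrix.det_eq_zero_of_row_eq_zero k
      intro q
      have hc : ContinuousAt (fun z : E => pd (φ k) q (z.1 + z.2)) (u0, 0) := by
        have h1 : AnalyticAt ℂ (pd (φ k) q) ((u0, (0 : Fin n → ℂ)).1 + (u0, (0 : Fin n → ℂ)).2) := by
          simpa using pd_analyticAt (hu0 k) q
        exact (AnalyticAt.comp (f := fun z : E => z.1 + z.2) h1 (hadd (u0, 0))).continuousAt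
      have := aux_closure hWdense hc (hpd q)
      simpa using this)
  let H1 := rename (reIdx n) H
  have hH1 : H1 ≠ 0 := fun h0 => hH0 (rename_injective _ (reIdx_inj n) (by simpa [H1] using h0))
  have hswap : Function.Injective (Sum.swap : (Fin n ⊕ Fin n) ⊕ (Fin n ⊕ Fin n) → _) :=
    Sum.swap_leftInverse.injective
  refine ⟨H1 * rename Sum.swap H1, mul_ne_zero hH1 ?_, ?_, ?_⟩
  · exact fun h0 => hH1 (rename_injective _ hswap (by simpa using h0))
  · have hss : rename Sum.swap (rename Sum.swap H1) = H1 := by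
      rw [rename_rename Sum.swap Sum.swap H1, Sum.swap_swap_eq, rename_id_apply]
    rw [map_mul, hss, mul_comm]
  · intro u v hu hu' hv hv'
    have key : eval (Sum.elim (fun i => t i (u, v)) fun i => a i (u, v)) H = 0 := by
      refine aux_closure hWdense
        (f := fun z => eval (Sum.elim (fun i => t i z) fun i => a i z) H)
        (eval_continuousAt ?_ H) hH
      rintro ((j | j) | (j | j))
      · exact (AnalyticAt.comp (g := pd (φ j) p) (hu' j p) (hfst (u, v))).continuousAt
      · exact (AnalyticAt.comp (g := pd (φ j) p) (hv' j p) (hsnd (u, v))).continuousAt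
      · exact (AnalyticAt.comp (g := φ j) (hu j) (hfst (u, v))).continuousAt
      · exact (AnalyticAt.comp (g := φ j) (hv j) (hsnd (u, v))).continuousAt
    rw [map_mul]
    apply mul_eq_zero_of_left
    rw [eval_rename, ← key]
    congr 2
    funext i
    rcases i with ((j | j) | (j | j)) <;> rfl
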